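/- Let D and 𝒯 be finite nonempty sets of cardinalities D and T respectively, and let n ≥ 1. Then T · t_{D,T}(n) = t_{TD,1}(n); that is, T times the number of D-decorated 𝒯-typed rooted trees with n vertices equals the number of (untyped) rooted trees with n vertices decorated by a set of cardinality TD. -/

import Mathlib

inductive PreTree (D T : Type) : Type
  | node : D → List (T × PreTree D T) → PreTree D T

namespace PreTree
variable {D T : Type}
mutual
def size : PreTree D T → ℕ
  | .node _ l => 1 + sizeL l
def sizeL : List (T × PreTree D T) → ℕ
  | [] => 0
  | (_, c) :: r => size c + sizeL r
end
inductive Swap : PreTree D T → PreTree D T → Prop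
  | swap (d : D) (l₁ l₂ : List (T × PreTree D T)) (p q : T × PreTree D T) :
      Swap (.node d (l₁ ++ p :: q :: l₂)) (.node d (l₁ ++ q :: p :: l₂))
  | congr (d : D) (l₁ l₂ : List (T × PreTree D T)) (t : T) (s s' : PreTree D T) :
      Swap s s' → Swap (.node d (l₁ ++ (t, s) :: l₂)) (.node d (l₁ ++ (t, s') :: l₂))
end PreTree

instance preTreeSetoid (D T : Type) : Setoid (PreTree D T) :=
  ⟨Relation.EqvGen PreTree.Swap, Relation.EqvGen.is_equivalence _⟩

abbrev TypedTree (D T : Type) : Type := Quotient (preTreeSetoid D T)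

/-- `t_{D,T}(n)`: the number of (isoclasses of) `D`-decorated `T`-typed rooted trees with
`n` vertices. -/
noncomputable def treeCard (D T : Type) (n : ℕ) : ℕ :=
  Nat.card {x : TypedTree D T // ∃ p : PreTree D T, ⟦p⟧ = x ∧ p.size = n}

/-- `f_{D,T}(n)`: the number of `D`-decorated `T`-typed rooted forests with `n` vertices,
a forest being a finite multiset of trees. -/
noncomputable def forestCard (D T : Type) (n : ℕ) : ℕ :=
  Nat.card {F : Multiset (TypedTree D T) //
    ∃ L : List (PreTree D T),
      (↑(L.map (fun p => (⟦p⟧ : TypedTree D T))) : Multiset (TypedTree D T)) = F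
      ∧ (L.map PreTree.size).sum = n}

noncomputable def treeSeries (D T : Type) : PowerSeries ℚ :=
  PowerSeries.mk fun n => if n = 0 then 0 else (treeCard D T n : ℚ)

noncomputable def forestSeries (D T : Type) : PowerSeries ℚ :=
  PowerSeries.mk fun n => (forestCard D T n : ℚ)

namespace PreTree
variable {D T : Type}

mutual
/-- Moves the edge types of a tree to the vertices below, giving the root the type `t`. -/
def pushType (t : T) : PreTree D T → PreTree (D × T) Unit
  | .node d l => .node (d, t) (pushTypeList l)
/-- `pushType` applied to every branch. -/
def pushTypeList : List (T × PreTree D T) → List (Unit × PreTree (D × T) Unit)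
  | [] => []
  | (s, c) :: r => ((), pushType s c) :: pushTypeList r
end

mutual
/-- Moves the second components of the decorations to the edges above; the one of the root is
returned separately. -/
def pullType : PreTree (D × T) Unit → T × PreTree D T
  | .node (d, t) l => (t, .node d (pullTypeList l))
/-- `pullType` applied to every branch. -/
def pullTypeList : List (Unit × PreTree (D × T) Unit) → List (T × PreTree D T)
  | [] => []
  | (_, c) :: r => pullType c :: pullTypeList r
end

mutual
theorem pullType_pushType (t : T) : ∀ p : PreTree D T, pullType (pushType t p) = (t, p)
  | .node d l => by rw [pushType, pullType, pullTypeList_pushTypeList l]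
theorem pullTypeList_pushTypeList :
    ∀ l : List (T × PreTree D T), pullTypeList (pushTypeList l) = l
  | [] => by rw [pushTypeList, pullTypeList]
  | (s, c) :: r => by
    rw [pushTypeList, pullTypeList, pullType_pushType s c, pullTypeList_pushTypeList r]
end

mutual
theorem pushType_pullType :
    ∀ q : PreTree (D × T) Unit, pushType (pullType q).1 (pullType q).2 = q
  | .node (d, t) l => by rw [pullType, pushType, pushTypeList_pullTypeList l]
theorem pushTypeList_pullTypeList :
    ∀ l : List (Unit × PreTree (D × T) Unit), pushTypeList (pullTypeList l) = l
  | [] => by rw [pullTypeList, pushTypeList]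
  | (_, c) :: r => by
    rw [pullTypeList, pushTypeList, pushType_pullType c, pushTypeList_pullTypeList r]
end

mutual
theorem size_pushType (t : T) : ∀ p : PreTree D T, (pushType t p).size = p.size
  | .node d l => by rw [pushType, size, size, sizeL_pushTypeList l]
theorem sizeL_pushTypeList :
    ∀ l : List (T × PreTree D T), sizeL (pushTypeList l) = sizeL l
  | [] => by rw [pushTypeList, sizeL, sizeL]
  | (s, c) :: r => by
    rw [pushTypeList, sizeL, sizeL, size_pushType s c, sizeL_pushTypeList r]
end

theorem pushTypeList_append (l₁ l₂ : List (T × PreTree D T)) :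
    pushTypeList (l₁ ++ l₂) = pushTypeList l₁ ++ pushTypeList l₂ := by
  induction l₁ with
  | nil => simp [pushTypeList]
  | cons a r ih => simp [pushTypeList, ih]

theorem pullTypeList_append (l₁ l₂ : List (Unit × PreTree (D × T) Unit)) :
    pullTypeList (l₁ ++ l₂) = pullTypeList l₁ ++ pullTypeList l₂ := by
  induction l₁ with
  | nil => simp [pullTypeList]
  | cons a r ih => simp [pullTypeList, ih]

theorem Swap.pushType {p p' : PreTree D T} (h : Swap p p') (t : T) :
    Swap (pushType t p) (pushType t p') := by
  induction h generalizing t with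
  | swap d l₁ l₂ p q =>
    simp only [PreTree.pushType, pushTypeList_append, pushTypeList]
    exact .swap _ _ _ _ _
  | congr d l₁ l₂ s c c' _ ih =>
    simp only [PreTree.pushType, pushTypeList_append, pushTypeList]
    exact .congr _ _ _ _ _ _ (ih s)

theorem Swap.pullType {q q' : PreTree (D × T) Unit} (h : Swap q q') :
    (pullType q).1 = (pullType q').1 ∧ Swap (pullType q).2 (pullType q').2 := by
  induction h with
  | swap d l₁ l₂ p q =>
    simp only [PreTree.pullType, pullTypeList_append, pullTypeList, true_and]
    exact .swap _ _ _ _ _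
  | congr d l₁ l₂ s c c' _ ih =>
    simp only [PreTree.pullType, pullTypeList_append, pullTypeList, true_and]
    rw [← Prod.mk.eta (p := PreTree.pullType c), ← Prod.mk.eta (p := PreTree.pullType c'), ← ih.1]
    exact .congr _ _ _ _ _ _ ih.2

theorem pushType_equiv {p p' : PreTree D T} (h : p ≈ p') (t : T) :
    pushType t p ≈ pushType t p' := by
  induction h with
  | rel _ _ h => exact .rel _ _ (h.pushType t)
  | refl _ => exact .refl _
  | symm _ _ _ ih => exact .symm _ _ ih
  | trans _ _ _ _ _ ih₁ ih₂ => exact .trans _ _ _ ih₁ ih₂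

theorem pullType_equiv {q q' : PreTree (D × T) Unit} (h : q ≈ q') :
    (pullType q).1 = (pullType q').1 ∧ (pullType q).2 ≈ (pullType q').2 := by
  induction h with
  | rel _ _ h => exact ⟨h.pullType.1, .rel _ _ h.pullType.2⟩
  | refl _ => exact ⟨rfl, .refl _⟩
  | symm _ _ _ ih => exact ⟨ih.1.symm, .symm _ _ ih.2⟩
  | trans _ _ _ _ _ ih₁ ih₂ => exact ⟨ih₁.1.trans ih₂.1, .trans _ _ _ ih₁.2 ih₂.2⟩

end PreTree

open PreTree

/-- A typed tree together with a type for its root is an untyped tree whose decorations carry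
an additional type. -/
def TypedTree.prodEquiv (D T : Type) : T × TypedTree D T ≃ TypedTree (D × T) Unit where
  toFun z := Quotient.map (pushType z.1) (fun _ _ h => pushType_equiv h z.1) z.2
  invFun := Quotient.lift (fun q => ((pullType q).1, ⟦(pullType q).2⟧)) fun _ _ h =>
    Prod.ext (pullType_equiv h).1 (Quotient.sound (pullType_equiv h).2)
  left_inv := by
    rintro ⟨t, x⟩
    induction x using Quotient.inductionOn with
    | h p => simp [pullType_pushType]
  right_inv x := by
    induction x using Quotient.inductionOn with
    | h q => simp [pushType_pullType]

theorem TypedTree.exists_size_prodEquiv_iff {D T : Type} (n : ℕ) (z : T × TypedTree D T) :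
    (∃ p : PreTree D T, ⟦p⟧ = z.2 ∧ p.size = n) ↔
      ∃ q : PreTree (D × T) Unit, ⟦q⟧ = prodEquiv D T z ∧ q.size = n := by
  constructor
  · obtain ⟨t, x⟩ := z
    rintro ⟨p, rfl, hp⟩
    exact ⟨pushType t p, rfl, (size_pushType t p).trans hp⟩
  · rintro ⟨q, hq, hn⟩
    obtain rfl := (Equiv.symm_apply_eq _).mpr hq
    refine ⟨(pullType q).2, rfl, ?_⟩
    rw [← size_pushType (pullType q).1, pushType_pullType, hn]

/-- For finite nonempty `D` and `𝒯` of cardinalities `D` and `T`, and `n ≥ 1`,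
`T · t_{D,T}(n) = t_{TD,1}(n)`: `T` times the number of `D`-decorated `𝒯`-typed rooted trees with
`n` vertices equals the number of untyped rooted trees with `n` vertices decorated by a set of
cardinality `TD`. -/
theorem typed_tree_count_eq_untyped_count
    (D T : Type) [Fintype D] [Fintype T] [Nonempty D] [Nonempty T]
    (n : ℕ) (hn : 1 ≤ n) :
    Fintype.card T * treeCard D T n = treeCard (D × T) Unit n := by
  rw [treeCard, treeCard, ← Nat.card_eq_fintype_card, ← Nat.card_prod]
  refine Nat.card_congr (Equiv.trans ?_
    ((TypedTree.prodEquiv D T).subtypeEquiv (TypedTree.exists_size_prodEquiv_iff n)))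
  exact
    { toFun := fun z => ⟨(z.1, z.2.1), z.2.2⟩
      invFun := fun z => (z.1.1, ⟨z.1.2, z.2⟩) }
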